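/- arXiv:2509.19095 — 2 statements merged into one kernel-verified Lean document; each statement's English description precedes it below -/
import Mathlib

section
/- With the algorithm setup (n = dℓ, k = dr + c, c ∈ {−1,0,1}): the output collection D = L_1 ∪ … ∪ L_{ℓ−r+1} is weakly separated. -/
open Finset

/-- `x +_n t`: add `t` to `x ∈ [n] = {1,…,n}` modulo `n`, with representative in `[n]`. -/
def shiftMod (n t x : ℕ) : ℕ := (x + t - 1) % n + 1

/-- `S +_n t`: add `t` to every element of `S ⊆ [n]` modulo `n`. -/
def shiftSet (n t : ℕ) (S : Finset ℕ) : Finset ℕ := S.image (shiftMod n t)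

/-- `x +_n t` for an integer shift `t`. -/
def shiftModZ (n : ℕ) (t : ℤ) (x : ℕ) : ℕ := ((((x : ℤ) + t - 1) % (n : ℤ)) + 1).toNat

/-- `S +_n t` for an integer shift `t`. -/
def shiftSetZ (n : ℕ) (t : ℤ) (S : Finset ℕ) : Finset ℕ := S.image (shiftModZ n t)

/-- Two sets `S`, `T` are weakly separated if there are no `a < b < c < d` with
`a, c ∈ S \ T` and `b, d ∈ T \ S`, nor with the roles of `S` and `T` exchanged. -/
def WeaklySeparated (S T : Finset ℕ) : Prop :=
  ¬ ∃ a b c d : ℕ, a < b ∧ b < c ∧ c < d ∧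
    ((a ∈ S \ T ∧ c ∈ S \ T ∧ b ∈ T \ S ∧ d ∈ T \ S) ∨
     (a ∈ T \ S ∧ c ∈ T \ S ∧ b ∈ S \ T ∧ d ∈ S \ T))

/-- The cyclic successor of `x` in a finite set `P ⊆ ℕ`: the least element of `P`
greater than `x` if one exists, and otherwise the least element of `P`. -/
def cyclicSucc (P : Finset ℕ) (x : ℕ) : ℕ :=
  if h : (P.filter (fun y => x < y)).Nonempty then (P.filter (fun y => x < y)).min' h
  else if h2 : P.Nonempty then P.min' h2 else 0

open scoped Classical in
/-- The cyclic interval of `P` from `u` to `v`: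
`{u, S_P(u), …, S_P^m(u)}` where `m ≥ 0` is minimal with `S_P^m(u) = v`. -/
noncomputable def cyclicIntervalTo (P : Finset ℕ) (u v : ℕ) : Finset ℕ :=
  if h : ∃ m : ℕ, (cyclicSucc P)^[m] u = v then
    (Finset.range (Nat.find h + 1)).image (fun j => (cyclicSucc P)^[j] u)
  else ∅

/-- The orbit `ā = {a + iℓ : 0 ≤ i ≤ d−1} ⊆ [dℓ]` of `a ∈ [ℓ]`. -/
def orbit (d ℓ a : ℕ) : Finset ℕ := (Finset.range d).image (fun i => a + i * ℓ)

/-- `P_s = [n] \ (ā_{a_1} ∪ … ∪ ā_{a_{s−1}})`, where `n = dℓ`. -/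
def Pset (d ℓ : ℕ) (a : ℕ → ℕ) (s : ℕ) : Finset ℕ :=
  Finset.Icc 1 (d * ℓ) \ (Finset.Icc 1 (s - 1)).biUnion (fun i => orbit d ℓ (a i))

/-- `P_{s,h} = P_s \ {a_s +_n hℓ, …, a_s +_n (d−1)ℓ}` for `1 ≤ h ≤ d−1`; `P_{s,d} = P_s`. -/
def Psh (d ℓ : ℕ) (a : ℕ → ℕ) (s h : ℕ) : Finset ℕ :=
  Pset d ℓ a s \ (Finset.Ico h d).image (fun j => shiftMod (d * ℓ) (j * ℓ) (a s))

/-- `I(i,h) = {i, S_{P_{s,h}}(i), S_{P_{s,h}}²(i), …, S_{P_{s,h}}^{k−1}(i)}`. -/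
def Iih (d ℓ k : ℕ) (a : ℕ → ℕ) (s h i : ℕ) : Finset ℕ :=
  (Finset.range k).image (fun j => (cyclicSucc (Psh d ℓ a s h))^[j] i)

/-- `B_s = {I(i,h) : i` in the cyclic interval of `P_s` from `S_{P_s}(a_s +_n (n−ℓ))` to
`a_s`, `1 ≤ h ≤ d`, `|I(i,h)| = k}`. -/
noncomputable def Bset (d ℓ k : ℕ) (a : ℕ → ℕ) (s : ℕ) : Finset (Finset ℕ) :=
  (((cyclicIntervalTo (Pset d ℓ a s)
        (cyclicSucc (Pset d ℓ a s) (shiftMod (d * ℓ) (d * ℓ - ℓ) (a s)))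
        (a s)) ×ˢ (Finset.Icc 1 d)).image
      (fun p => Iih d ℓ k a s p.2 p.1)).filter (fun I => I.card = k)

/-- `L_s = {I +_n xℓ : I ∈ B_s, 1 ≤ x ≤ d}`. -/
noncomputable def Lset (d ℓ k : ℕ) (a : ℕ → ℕ) (s : ℕ) : Finset (Finset ℕ) :=
  ((Bset d ℓ k a s) ×ˢ (Finset.Icc 1 d)).image (fun p => shiftSet (d * ℓ) (p.2 * ℓ) p.1)

/-- The output collection `D = L_1 ∪ … ∪ L_{ℓ−r+1}`. -/
noncomputable def Dcol (d ℓ k r : ℕ) (a : ℕ → ℕ) : Finset (Finset ℕ) :=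
  (Finset.Icc 1 (ℓ - r + 1)).biUnion (fun s => Lset d ℓ k a s)

/-- The map `F : [n] → [dℓ]`, `F(a + gx) = a + ℓx` for `1 ≤ a ≤ g`, `0 ≤ x ≤ d−1`. -/
def Fmap (g ℓ y : ℕ) : ℕ := (y - 1) % g + 1 + ℓ * ((y - 1) / g)

theorem WeaklySeparated.symm {S T : Finset ℕ} (h : WeaklySeparated S T) :
    WeaklySeparated T S := by
  rintro ⟨a, b, c, d, hab, hbc, hcd, h'⟩
  exact h ⟨a, b, c, d, hab, hbc, hcd, h'.symm⟩

theorem weaklySeparated_of_card_le_one {S T : Finset ℕ} (h : S.card ≤ 1) :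
    WeaklySeparated S T := by
  rw [card_le_one] at h
  rintro ⟨a, b, c, d, hab, hbc, hcd, ⟨h1, h2, -, -⟩ | ⟨-, -, h1, h2⟩⟩ <;>
  · have := h _ (mem_sdiff.1 h1).1 _ (mem_sdiff.1 h2).1
    omega

/-- The clockwise distance from `i` to `y` on the cycle `[n]`. -/
def cyclicDist (n i y : ℕ) : ℕ := if i ≤ y then y - i else y + n - i

/-- `S` consists of the elements of `P` on some arc of the cycle `[n]`, where the elements of
`P ∩ A` are only taken from an initial segment of that arc. -/
def IsTruncatedArc (n : ℕ) (P A S : Finset ℕ) : Prop :=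
  ∃ i L K : ℕ, i ∈ Icc 1 n ∧
    ∀ y, y ∈ S ↔ y ∈ P ∧ cyclicDist n i y < L ∧ (y ∈ A → cyclicDist n i y < K)

theorem not_alternating_of_dist_lt {n i L a b c d : ℕ} (hi : i ∈ Icc 1 n)
    (ha : a ∈ Icc 1 n) (hd : d ∈ Icc 1 n) (hab : a < b) (hbc : b < c) (hcd : c < d) :
    ¬ (cyclicDist n i a < L ∧ cyclicDist n i c < L ∧
        L ≤ cyclicDist n i b ∧ L ≤ cyclicDist n i d) ∧
    ¬ (cyclicDist n i b < L ∧ cyclicDist n i d < L ∧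
        L ≤ cyclicDist n i a ∧ L ≤ cyclicDist n i c) := by
  simp only [mem_Icc] at *
  unfold cyclicDist
  constructor <;> split_ifs <;> omega

theorem cyclicDist_cases (n i : ℕ) {a b c d : ℕ} (hab : a < b) (hbc : b < c) (hcd : c < d) :
    (i ≤ a ∧ cyclicDist n i a = a - i ∧ cyclicDist n i b = b - i ∧
      cyclicDist n i c = c - i ∧ cyclicDist n i d = d - i) ∨
    (a < i ∧ i ≤ b ∧ cyclicDist n i a = a + n - i ∧ cyclicDist n i b = b - i ∧
      cyclicDist n i c = c - i ∧ cyclicDist n i d = d - i) ∨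
    (b < i ∧ i ≤ c ∧ cyclicDist n i a = a + n - i ∧ cyclicDist n i b = b + n - i ∧
      cyclicDist n i c = c - i ∧ cyclicDist n i d = d - i) ∨
    (c < i ∧ i ≤ d ∧ cyclicDist n i a = a + n - i ∧ cyclicDist n i b = b + n - i ∧
      cyclicDist n i c = c + n - i ∧ cyclicDist n i d = d - i) ∨
    (d < i ∧ cyclicDist n i a = a + n - i ∧ cyclicDist n i b = b + n - i ∧
      cyclicDist n i c = c + n - i ∧ cyclicDist n i d = d + n - i) := by
  unfold cyclicDist
  split_ifs <;> omega

set_option maxHeartbeats 2000000 in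
theorem not_alternating_of_truncated {n i i' L K L' K' a b c d : ℕ} {A : Finset ℕ}
    (hi : i ∈ Icc 1 n) (hi' : i' ∈ Icc 1 n)
    (ha : a ∈ Icc 1 n) (hd : d ∈ Icc 1 n)
    (hab : a < b) (hbc : b < c) (hcd : c < d)
    (a1 : cyclicDist n i a < L ∧ (a ∈ A → cyclicDist n i a < K))
    (c1 : cyclicDist n i c < L ∧ (c ∈ A → cyclicDist n i c < K))
    (b1 : cyclicDist n i' b < L' ∧ (b ∈ A → cyclicDist n i' b < K'))
    (d1 : cyclicDist n i' d < L' ∧ (d ∈ A → cyclicDist n i' d < K'))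
    (a2 : ¬ (cyclicDist n i' a < L' ∧ (a ∈ A → cyclicDist n i' a < K')))
    (c2 : ¬ (cyclicDist n i' c < L' ∧ (c ∈ A → cyclicDist n i' c < K')))
    (b2 : ¬ (cyclicDist n i b < L ∧ (b ∈ A → cyclicDist n i b < K)))
    (d2 : ¬ (cyclicDist n i d < L ∧ (d ∈ A → cyclicDist n i d < K))) : False := by
  have key : ∀ (j M N y : ℕ), (cyclicDist n j y < M ∧ (y ∈ A → cyclicDist n j y < N)) ↔
      cyclicDist n j y < if y ∈ A then min M N else M := by
    intro j M N y
    split_ifs with h <;> simp [h]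
  rw [key] at a1 b1 c1 d1 a2 b2 c2 d2
  have hm : min L K ≤ L := min_le_left _ _
  have hm' : min L' K' ≤ L' := min_le_left _ _
  generalize min L K = M at *
  generalize min L' K' = M' at *
  have h1 := cyclicDist_cases n i hab hbc hcd
  have h2 := cyclicDist_cases n i' hab hbc hcd
  generalize cyclicDist n i = f at *
  generalize cyclicDist n i' = g at *
  rw [mem_Icc] at hi hi' ha hd
  by_cases hA : a ∈ A <;> by_cases hB : b ∈ A <;> by_cases hC : c ∈ A <;> by_cases hD : d ∈ A <;>
    simp only [hA, hB, hC, hD, if_true, if_false] at a1 b1 c1 d1 a2 b2 c2 d2 <;>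
    clear hA hB hC hD key <;>
    rcases h1 with h1 | h1 | h1 | h1 | h1 <;> rcases h2 with h2 | h2 | h2 | h2 | h2 <;> omega

theorem weaklySeparated_of_isTruncatedArc {n : ℕ} {P A S T : Finset ℕ}
    (hP : ∀ y ∈ P, y ∈ Icc 1 n) (hS : IsTruncatedArc n P A S) (hT : IsTruncatedArc n P A T) :
    WeaklySeparated S T := by
  obtain ⟨i, L, K, hi, hS⟩ := hS
  obtain ⟨i', L', K', hi', hT⟩ := hT
  rintro ⟨a, b, c, d, hab, hbc, hcd, ⟨ha, hc, hb, hd⟩ | ⟨ha, hc, hb, hd⟩⟩ <;>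
    simp only [mem_sdiff, hS, hT] at ha hb hc hd
  · exact not_alternating_of_truncated hi hi' (hP _ ha.1.1) (hP _ hd.1.1) hab hbc hcd
      ha.1.2 hc.1.2 hb.1.2 hd.1.2 (fun h => ha.2 ⟨ha.1.1, h⟩) (fun h => hc.2 ⟨hc.1.1, h⟩)
      (fun h => hb.2 ⟨hb.1.1, h⟩) (fun h => hd.2 ⟨hd.1.1, h⟩)
  · exact not_alternating_of_truncated hi' hi (hP _ ha.1.1) (hP _ hd.1.1) hab hbc hcd
      ha.1.2 hc.1.2 hb.1.2 hd.1.2 (fun h => ha.2 ⟨ha.1.1, h⟩) (fun h => hc.2 ⟨hc.1.1, h⟩)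
      (fun h => hb.2 ⟨hb.1.1, h⟩) (fun h => hd.2 ⟨hd.1.1, h⟩)

theorem mem_Pset {d ℓ s y : ℕ} {a : ℕ → ℕ} :
    y ∈ Pset d ℓ a s ↔ y ∈ Icc 1 (d * ℓ) ∧ ∀ t, 1 ≤ t → t < s → y ∉ orbit d ℓ (a t) := by
  simp only [Pset, mem_sdiff, mem_biUnion, not_exists, not_and, mem_Icc]
  refine and_congr_right fun _ => forall_congr' fun t => ⟨fun h h1 h2 => h ⟨h1, by omega⟩,
    fun h h1 => h h1.1 (by omega)⟩

theorem weaklySeparated_of_lt {d ℓ s t : ℕ} {a : ℕ → ℕ} {S T : Finset ℕ} (hs : 1 ≤ s)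
    (hst : s < t) (hS : IsTruncatedArc (d * ℓ) (Pset d ℓ a s) (orbit d ℓ (a s)) S)
    (hT : IsTruncatedArc (d * ℓ) (Pset d ℓ a t) (orbit d ℓ (a t)) T) :
    WeaklySeparated S T := by
  obtain ⟨i, L, K, hi, hS⟩ := hS
  obtain ⟨i', L', K', -, hT⟩ := hT
  have hin : ∀ y, y ∈ S \ T → y ∈ Icc 1 (d * ℓ) ∧ cyclicDist (d * ℓ) i y < L := by
    intro y hy
    have := (hS y).1 (mem_sdiff.1 hy).1
    exact ⟨(mem_Pset.1 this.1).1, this.2.1⟩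
  have hout : ∀ y, y ∈ T \ S → y ∈ Icc 1 (d * ℓ) ∧ L ≤ cyclicDist (d * ℓ) i y := by
    intro y hy
    rw [mem_sdiff, hS, hT, mem_Pset, mem_Pset] at hy
    obtain ⟨⟨⟨h1, h2⟩, -⟩, h3⟩ := hy
    refine ⟨h1, not_lt.1 fun h4 => h3 ⟨⟨h1, fun u hu hu' => h2 u hu (hu'.trans hst)⟩, h4,
      fun h5 => absurd h5 (h2 s hs hst)⟩⟩
  rintro ⟨a, b, c, e, hab, hbc, hce, ⟨ha, hc, hb, he⟩ | ⟨ha, hc, hb, he⟩⟩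
  · exact (not_alternating_of_dist_lt hi (hin a ha).1 (hout e he).1
      hab hbc hce).1 ⟨(hin a ha).2, (hin c hc).2, (hout b hb).2, (hout e he).2⟩
  · exact (not_alternating_of_dist_lt hi (hout a ha).1 (hin e he).1
      hab hbc hce).2 ⟨(hin b hb).2, (hin e he).2, (hout a ha).2, (hout c hc).2⟩

theorem card_le_of_mem_Lset {d ℓ k s : ℕ} {a : ℕ → ℕ} {I : Finset ℕ}
    (hI : I ∈ Lset d ℓ k a s) : I.card ≤ k := by
  simp only [Lset, Bset, mem_image, mem_product, mem_filter] at hI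
  obtain ⟨⟨J, x⟩, ⟨⟨-, hJ⟩, -⟩, rfl⟩ := hI
  exact card_image_le.trans hJ.le

theorem cyclicSucc_mem {P : Finset ℕ} (hP : P.Nonempty) (x : ℕ) : cyclicSucc P x ∈ P := by
  unfold cyclicSucc
  split_ifs with h
  · exact (mem_filter.1 (min'_mem _ h)).1
  · exact min'_mem _ _

theorem cyclicSucc_cases {P : Finset ℕ} (hP : P.Nonempty) (x : ℕ) :
    (x < cyclicSucc P x ∧ ∀ y ∈ P, x < y → cyclicSucc P x ≤ y) ∨
      (∀ y ∈ P, y ≤ x ∧ cyclicSucc P x ≤ y) := by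
  unfold cyclicSucc
  split_ifs with h
  · exact .inl ⟨(mem_filter.1 (min'_mem _ h)).2,
      fun y hy hxy => min'_le _ _ (mem_filter.2 ⟨hy, hxy⟩)⟩
  · refine .inr fun y hy => ⟨not_lt.1 fun hxy => h ⟨y, mem_filter.2 ⟨hy, hxy⟩⟩, min'_le _ _ hy⟩

theorem iterate_cyclicSucc_mem {P : Finset ℕ} {i : ℕ} (hi : i ∈ P) (j : ℕ) :
    (cyclicSucc P)^[j] i ∈ P := by
  cases j with
  | zero => exact hi
  | succ j => rw [Function.iterate_succ_apply']; exact cyclicSucc_mem ⟨i, hi⟩ _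

theorem exists_iterate_cyclicSucc_eq {n i : ℕ} {P : Finset ℕ} (hP : ∀ y ∈ P, y ∈ Icc 1 n)
    (hi : i ∈ P) (j : ℕ) {z : ℕ} (hz : z ∈ P)
    (h : cyclicDist n i z ≤ cyclicDist n i ((cyclicSucc P)^[j] i)) :
    ∃ j' ≤ j, (cyclicSucc P)^[j'] i = z := by
  induction j with
  | zero =>
    refine ⟨0, le_rfl, ?_⟩
    have h1 := mem_Icc.1 (hP i hi)
    have h2 := mem_Icc.1 (hP z hz)
    simp only [Function.iterate_zero, id] at h ⊢
    unfold cyclicDist at h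
    split_ifs at h <;> omega
  | succ j ih =>
    by_cases hlt : cyclicDist n i z ≤ cyclicDist n i ((cyclicSucc P)^[j] i)
    · obtain ⟨j', hj', e⟩ := ih hlt
      exact ⟨j', hj'.trans j.le_succ, e⟩
    · refine ⟨j + 1, le_rfl, ?_⟩
      have hw := iterate_cyclicSucc_mem hi j
      have hw' := iterate_cyclicSucc_mem hi (j + 1)
      rw [Function.iterate_succ_apply'] at h hw' ⊢
      generalize (cyclicSucc P)^[j] i = w at *
      have hc := cyclicSucc_cases ⟨i, hi⟩ w
      generalize cyclicSucc P w = w' at *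
      have h1 := mem_Icc.1 (hP i hi)
      have h2 := mem_Icc.1 (hP z hz)
      have h3 := mem_Icc.1 (hP w hw)
      have h4 := mem_Icc.1 (hP w' hw')
      rcases hc with ⟨hc1, hc2⟩ | hc
      · have h5 := hc2 z hz
        have h6 := hc2 i hi
        unfold cyclicDist at *
        split_ifs at * <;> omega
      · have h5 := hc z hz
        have h6 := hc i hi
        unfold cyclicDist at *
        split_ifs at * <;> omega

theorem exists_mem_image_iterate_cyclicSucc_iff {n i : ℕ} {P : Finset ℕ}
    (hP : ∀ y ∈ P, y ∈ Icc 1 n) (hi : i ∈ P) (k : ℕ) :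
    ∃ L, ∀ y, y ∈ (range k).image (fun j => (cyclicSucc P)^[j] i) ↔
      y ∈ P ∧ cyclicDist n i y < L := by
  refine ⟨(range k).sup fun j => cyclicDist n i ((cyclicSucc P)^[j] i) + 1, fun y => ?_⟩
  simp only [Finset.lt_sup_iff, mem_image, mem_range]
  constructor
  · rintro ⟨j, hj, rfl⟩
    exact ⟨iterate_cyclicSucc_mem hi j, j, hj, Nat.lt_succ_self _⟩
  · rintro ⟨hy, j, hj, h⟩
    obtain ⟨j', hj', e⟩ := exists_iterate_cyclicSucc_eq hP hi j hy (Nat.lt_succ_iff.1 h)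
    exact ⟨j', hj'.trans_lt hj, e⟩

theorem mem_of_mem_cyclicIntervalTo {P : Finset ℕ} {e v i : ℕ} (hv : v ∈ P)
    (hi : i ∈ cyclicIntervalTo P (cyclicSucc P e) v) : i ∈ P ∧ (i ≤ v ∨ e < i) := by
  classical
  unfold cyclicIntervalTo at hi
  split_ifs at hi with h
  · simp only [mem_image, mem_range] at hi
    obtain ⟨j, hj, rfl⟩ := hi
    refine ⟨iterate_cyclicSucc_mem (cyclicSucc_mem ⟨v, hv⟩ _) j, ?_⟩
    induction j with
    | zero =>
      rcases cyclicSucc_cases ⟨v, hv⟩ e with h1 | h1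
      · exact .inr h1.1
      · exact .inl (h1 v hv).2
    | succ j ih =>
      have hne := Nat.find_min h (m := j) (by omega)
      have ih := ih (by omega)
      rw [Function.iterate_succ_apply']
      generalize (cyclicSucc P)^[j] (cyclicSucc P e) = w at *
      rcases cyclicSucc_cases ⟨v, hv⟩ w with ⟨h1, h2⟩ | h1
      · have := h2 v hv
        omega
      · exact .inl (h1 v hv).2
  · simp at hi

theorem shiftMod_eq {n t x : ℕ} (hx : x ∈ Icc 1 n) (ht : t ≤ n) :
    shiftMod n t x = if x + t ≤ n then x + t else x + t - n := by
  rw [mem_Icc] at hx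
  unfold shiftMod
  split_ifs with h
  · rw [Nat.mod_eq_of_lt (by omega)]; omega
  · rw [Nat.mod_eq_sub_mod (by omega), Nat.mod_eq_of_lt (by omega)]; omega

theorem shiftMod_mem {n t x : ℕ} (hx : x ∈ Icc 1 n) (ht : t ≤ n) : shiftMod n t x ∈ Icc 1 n := by
  rw [shiftMod_eq hx ht]
  rw [mem_Icc] at *
  split_ifs <;> omega

theorem shiftMod_sub_eq_iff {n t x y : ℕ} (hx : x ∈ Icc 1 n) (hy : y ∈ Icc 1 n) (ht : t ≤ n) :
    shiftMod n t x = y ↔ shiftMod n (n - t) y = x := by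
  rw [shiftMod_eq hx ht, shiftMod_eq hy (Nat.sub_le _ _)]
  rw [mem_Icc] at *
  split_ifs <;> omega

theorem cyclicDist_shiftMod_sub {n t i y : ℕ} (hi : i ∈ Icc 1 n) (hy : y ∈ Icc 1 n)
    (ht : t ≤ n) : cyclicDist n i (shiftMod n (n - t) y) = cyclicDist n (shiftMod n t i) y := by
  rw [shiftMod_eq hi ht, shiftMod_eq hy (Nat.sub_le _ _)]
  rw [mem_Icc] at *
  unfold cyclicDist
  split_ifs <;> omega

theorem mem_shiftSet {n t y : ℕ} {R : Finset ℕ} (hR : ∀ y ∈ R, y ∈ Icc 1 n) (ht : t ≤ n) :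
    y ∈ shiftSet n t R ↔ y ∈ Icc 1 n ∧ shiftMod n (n - t) y ∈ R := by
  simp only [shiftSet, mem_image]
  constructor
  · rintro ⟨z, hz, rfl⟩
    have h := shiftMod_mem (hR z hz) ht
    exact ⟨h, by rwa [(shiftMod_sub_eq_iff (hR z hz) h ht).1 rfl]⟩
  · rintro ⟨hy, h⟩
    exact ⟨_, h, (shiftMod_sub_eq_iff (hR _ h) hy ht).2 rfl⟩

theorem mem_orbit_iff {d ℓ b y : ℕ} (hb : b ∈ Set.Icc 1 ℓ) (hy : y ∈ Icc 1 (d * ℓ)) :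
    y ∈ orbit d ℓ b ↔ y ≡ b [MOD ℓ] := by
  obtain ⟨hb1, hb2⟩ := hb
  rw [mem_Icc] at hy
  simp only [orbit, mem_image, mem_range]
  constructor
  · rintro ⟨j, -, rfl⟩
    simp [Nat.ModEq]
  · intro h
    have hle : b ≤ y := by
      by_contra hlt
      have h1 := (Nat.modEq_iff_dvd' (by omega)).1 h
      have := Nat.le_of_dvd (by omega) h1
      omega
    obtain ⟨j, hj⟩ := (Nat.modEq_iff_dvd' hle).1 h.symm
    refine ⟨j, ?_, by rw [mul_comm] at hj; omega⟩
    by_contra hlt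
    have := Nat.mul_le_mul_left ℓ (not_lt.1 hlt)
    rw [mul_comm ℓ d] at this
    omega

theorem shiftMod_modEq {d ℓ x y : ℕ} (hy : y ∈ Icc 1 (d * ℓ)) (hx : x ≤ d) :
    shiftMod (d * ℓ) (x * ℓ) y ≡ y [MOD ℓ] := by
  have hxl := Nat.mul_le_mul_right ℓ hx
  rw [shiftMod_eq hy hxl]
  split_ifs with h
  · simp [Nat.ModEq]
  · refine Nat.ModEq.add_right_cancel (Nat.ModEq.refl (d * ℓ)) ?_
    rw [Nat.sub_add_cancel (by omega)]
    simp [Nat.ModEq]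

theorem shiftMod_mem_orbit_iff {d ℓ b x y : ℕ} (hb : b ∈ Set.Icc 1 ℓ) (hy : y ∈ Icc 1 (d * ℓ))
    (hx : x ≤ d) : shiftMod (d * ℓ) (x * ℓ) y ∈ orbit d ℓ b ↔ y ∈ orbit d ℓ b := by
  rw [mem_orbit_iff hb hy, mem_orbit_iff hb (shiftMod_mem hy (Nat.mul_le_mul_right ℓ hx))]
  have h := shiftMod_modEq hy hx
  exact ⟨h.symm.trans, h.trans⟩

theorem shiftMod_mem_Pset_iff {d ℓ s x y : ℕ} {a : ℕ → ℕ}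
    (ha : Set.BijOn a (Set.Icc 1 ℓ) (Set.Icc 1 ℓ)) (hs : s ≤ ℓ) (hy : y ∈ Icc 1 (d * ℓ))
    (hx : x ≤ d) : shiftMod (d * ℓ) (x * ℓ) y ∈ Pset d ℓ a s ↔ y ∈ Pset d ℓ a s := by
  rw [mem_Pset, mem_Pset]
  simp only [hy, shiftMod_mem hy (Nat.mul_le_mul_right ℓ hx), true_and]
  refine forall_congr' fun t => forall_congr' fun h1 => forall_congr' fun h2 => not_congr ?_
  exact shiftMod_mem_orbit_iff (ha.mapsTo ⟨h1, by omega⟩) hy hx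

theorem shiftMod_mul_eq {d ℓ b j : ℕ} (hb : b ∈ Set.Icc 1 ℓ) (hj : j < d) :
    shiftMod (d * ℓ) (j * ℓ) b = b + j * ℓ := by
  obtain ⟨h1, h2⟩ := hb
  have h := Nat.mul_le_mul_right ℓ (Nat.succ_le_of_lt hj)
  rw [Nat.succ_mul] at h
  rw [shiftMod_eq (mem_Icc.2 ⟨h1, by omega⟩) (by omega), if_pos (by omega)]

theorem self_mem_Pset {d ℓ s : ℕ} {a : ℕ → ℕ} (hd : 1 ≤ d)
    (ha : Set.BijOn a (Set.Icc 1 ℓ) (Set.Icc 1 ℓ)) (hs1 : 1 ≤ s) (hs : s ≤ ℓ) :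
    a s ∈ Pset d ℓ a s := by
  have hmem := ha.mapsTo ⟨hs1, hs⟩
  have hl := Nat.mul_le_mul_right ℓ hd
  have hI : a s ∈ Icc 1 (d * ℓ) := mem_Icc.2 ⟨hmem.1, by have := hmem.2; omega⟩
  refine mem_Pset.2 ⟨hI, fun t h1 h2 h => ?_⟩
  have ht := ha.mapsTo (⟨h1, by omega⟩ : t ∈ Set.Icc 1 ℓ)
  simp only [orbit, mem_image, mem_range] at h
  obtain ⟨j, -, hj⟩ := h
  rcases Nat.eq_zero_or_pos j with rfl | hj0
  · have := ha.injOn ⟨h1, by omega⟩ ⟨hs1, hs⟩ (by simpa using hj)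
    omega
  · have := Nat.le_mul_of_pos_left ℓ hj0
    have := hmem.2
    have := ht.1
    omega

theorem mem_Psh_iff {d ℓ s h i y : ℕ} {a : ℕ → ℕ} (hb : a s ∈ Set.Icc 1 ℓ)
    (hi : i ∈ Icc 1 (d * ℓ)) (hia : i ≤ a s ∨ a s + (d - 1) * ℓ < i) (h1 : 1 ≤ h) (hd : h ≤ d) :
    y ∈ Psh d ℓ a s h ↔ y ∈ Pset d ℓ a s ∧ (y ∈ orbit d ℓ (a s) →
      cyclicDist (d * ℓ) i y < cyclicDist (d * ℓ) i (a s + (h - 1) * ℓ) + 1) := by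
  have hl : 0 < ℓ := by have := hb.1; have := hb.2; omega
  have hlt : ∀ j < d, cyclicDist (d * ℓ) i (a s + j * ℓ) <
      cyclicDist (d * ℓ) i (a s + (h - 1) * ℓ) + 1 ↔ j < h := by
    intro j hj
    have e1 : j * ℓ ≤ (h - 1) * ℓ ↔ j ≤ h - 1 := Nat.mul_le_mul_right_iff hl
    have e2 := Nat.mul_le_mul_right ℓ (show j ≤ d - 1 by omega)
    have e3 := Nat.mul_le_mul_right ℓ (show h - 1 ≤ d - 1 by omega)
    rw [mem_Icc] at hi
    rw [show j < h ↔ j ≤ h - 1 by omega, ← e1]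
    unfold cyclicDist
    split_ifs <;> omega
  simp only [Psh, mem_sdiff, mem_image, mem_Ico, orbit, mem_range]
  refine and_congr_right fun _ => ⟨?_, ?_⟩
  · rintro hy ⟨j, hj, rfl⟩
    rw [hlt j hj]
    by_contra hjh
    exact hy ⟨j, ⟨not_lt.1 hjh, hj⟩, shiftMod_mul_eq hb hj⟩
  · rintro hy ⟨j, ⟨hj1, hj2⟩, rfl⟩
    rw [shiftMod_mul_eq hb hj2] at hy
    have := (hlt j hj2).1 (hy ⟨j, hj2, rfl⟩)
    omega

theorem isTruncatedArc_of_mem_Lset {d ℓ k s : ℕ} {a : ℕ → ℕ} {I : Finset ℕ} (hd : 1 ≤ d)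
    (ha : Set.BijOn a (Set.Icc 1 ℓ) (Set.Icc 1 ℓ)) (hs1 : 1 ≤ s) (hs : s ≤ ℓ)
    (hI : I ∈ Lset d ℓ k a s) :
    IsTruncatedArc (d * ℓ) (Pset d ℓ a s) (orbit d ℓ (a s)) I := by
  simp only [Lset, Bset, mem_image, mem_product, mem_filter, Prod.exists] at hI
  obtain ⟨J, x, ⟨⟨⟨i, h, ⟨hi, hh⟩, rfl⟩, -⟩, hx⟩, rfl⟩ := hI
  have hb := ha.mapsTo ⟨hs1, hs⟩
  have hsub : d * ℓ - ℓ = (d - 1) * ℓ := by rw [Nat.sub_mul, one_mul]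
  rw [hsub, shiftMod_mul_eq hb (by omega)] at hi
  obtain ⟨hiP, hia⟩ := mem_of_mem_cyclicIntervalTo (self_mem_Pset hd ha hs1 hs) hi
  have hin := (mem_Pset.1 hiP).1
  rw [mem_Icc] at hh hx
  have hmem := fun y => mem_Psh_iff (y := y) hb hin hia hh.1 hh.2
  have hPn : ∀ y ∈ Psh d ℓ a s h, y ∈ Icc 1 (d * ℓ) :=
    fun y hy => (mem_Pset.1 ((hmem y).1 hy).1).1
  have hi' : i ∈ Psh d ℓ a s h := (hmem i).2 ⟨hiP, fun _ => by simp [cyclicDist]⟩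
  obtain ⟨L, hL⟩ := exists_mem_image_iterate_cyclicSucc_iff hPn hi' k
  have hxl := Nat.mul_le_mul_right ℓ hx.2
  have hshift : d * ℓ - x * ℓ = (d - x) * ℓ := by rw [Nat.sub_mul]
  refine ⟨shiftMod (d * ℓ) (x * ℓ) i, L, cyclicDist (d * ℓ) i (a s + (h - 1) * ℓ) + 1,
    shiftMod_mem hin hxl, fun y => ?_⟩
  rw [Iih, mem_shiftSet (fun y hy => hPn y ((hL y).1 hy).1) hxl, hL, hmem]
  by_cases hy : y ∈ Icc 1 (d * ℓ)
  · rw [cyclicDist_shiftMod_sub hin hy hxl, hshift, shiftMod_mem_Pset_iff ha hs hy (Nat.sub_le _ _),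
      shiftMod_mem_orbit_iff hb hy (Nat.sub_le _ _)]
    tauto
  · have : y ∉ Pset d ℓ a s := fun h => hy (mem_Pset.1 h).1
    tauto

/-- With the algorithm setup (`n = dℓ`, `k = dr + c`, `c ∈ {−1,0,1}`):
the output collection `D = L_1 ∪ … ∪ L_{ℓ−r+1}` is weakly separated. -/
theorem stmt14 (d ℓ k : ℕ) (hd : 1 ≤ d) (hl : 1 ≤ ℓ) (hk1 : 1 ≤ k) (hk2 : 2 * k ≤ d * ℓ)
    (a : ℕ → ℕ) (ha : Set.BijOn a (Set.Icc 1 ℓ) (Set.Icc 1 ℓ))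
    (r : ℕ) (c : ℤ) (hc : c = -1 ∨ c = 0 ∨ c = 1) (hk : (k : ℤ) = d * r + c) :
    ∀ I ∈ Dcol d ℓ k r a, ∀ J ∈ Dcol d ℓ k r a, WeaklySeparated I J := by
  intro I hI J hJ
  simp only [Dcol, mem_biUnion, mem_Icc] at hI hJ
  obtain ⟨s, ⟨hs1, hs2⟩, hI⟩ := hI
  obtain ⟨t, ⟨ht1, ht2⟩, hJ⟩ := hJ
  rcases Nat.eq_zero_or_pos r with hr | hr
  · have hk1 : k = 1 := by subst hr; simp at hk; omega
    subst hk1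
    exact weaklySeparated_of_card_le_one (card_le_of_mem_Lset hI)
  · have hI' := isTruncatedArc_of_mem_Lset hd ha hs1 (by omega) hI
    have hJ' := isTruncatedArc_of_mem_Lset hd ha ht1 (by omega) hJ
    rcases lt_trichotomy s t with h | h | h
    · exact weaklySeparated_of_lt hs1 h hI' hJ'
    · subst h
      exact weaklySeparated_of_isTruncatedArc (fun y hy => (mem_Pset.1 hy).1) hI' hJ'
    · exact (weaklySeparated_of_lt ht1 h hJ' hI').symm
end

section
/- Let n, ℓ be positive integers with g = gcd(n, ℓ) satisfying 1 < g < ℓ, and set d = n/g. Define F : [n] → [dℓ] by F(a + gx) = a + ℓx for 1 ≤ a ≤ g and 0 ≤ x ≤ d−1 (every element of [n] is uniquely of the form a + gx), and let A = F([n]) ⊆ [dℓ]. Then F ∘ S_{[n]} = S_A ∘ F, where S_{[n]} and S_A denote the cyclic successor functions on [n] and on A respectively. -/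
open Finset

/-- A map that is strictly increasing on `P` intertwines the cyclic successor functions of `P`
and of its image. -/
theorem StrictMonoOn.map_cyclicSucc {P : Finset ℕ} {f : ℕ → ℕ} (hf : StrictMonoOn f P) {y : ℕ}
    (hy : y ∈ P) : f (cyclicSucc P y) = cyclicSucc (P.image f) (f y) := by
  have hfilter : (P.image f).filter (fun z => f y < z) =
      (P.filter (fun z => y < z)).image f := by
    rw [Finset.filter_image]
    congr 1
    exact Finset.filter_congr fun z hz => hf.lt_iff_lt hy hz
  have hmin : ∀ Q ⊆ P, ∀ h : Q.Nonempty, f (Q.min' h) = (Q.image f).min' (h.image f) := by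
    intro Q hQ h
    refine ((Finset.min'_eq_iff _ _ _).2 ⟨mem_image_of_mem f (Q.min'_mem h), ?_⟩).symm
    rintro _ hb
    obtain ⟨z, hz, rfl⟩ := mem_image.1 hb
    exact hf.monotoneOn (hQ (Q.min'_mem h)) (hQ hz) (Q.min'_le z hz)
  have hP : P.Nonempty := ⟨y, hy⟩
  unfold cyclicSucc
  simp only [hfilter, Finset.image_nonempty]
  split_ifs
  · exact hmin _ (Finset.filter_subset _ _) _
  · exact hmin P subset_rfl hP

theorem strictMonoOn_Fmap {g ℓ : ℕ} (hg : 0 < g) (hgl : g ≤ ℓ) :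
    StrictMonoOn (Fmap g ℓ) (Set.Ici 1) := by
  intro a ha b _ hab
  have hlt : a - 1 < b - 1 := by
    have : 1 ≤ a := ha
    omega
  unfold Fmap
  rcases (Nat.div_le_div_right (c := g) hlt.le).eq_or_lt with heq | hq
  · have hr : (a - 1) % g < (b - 1) % g := by
      have h1 := Nat.div_add_mod (a - 1) g
      have h2 := Nat.div_add_mod (b - 1) g
      rw [heq] at h1
      omega
    rw [heq]
    omega
  · have hmod := Nat.mod_lt (a - 1) hg
    have hmul := Nat.mul_le_mul_left ℓ (Nat.succ_le_of_lt hq)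
    rw [Nat.mul_succ] at hmul
    omega

/-- Let `g = gcd(n, ℓ)` with `1 < g < ℓ`, `d = n/g`, and let
`F : [n] → [dℓ]` be `F(a + gx) = a + ℓx` for `1 ≤ a ≤ g`, `0 ≤ x ≤ d−1`, with image
`A = F([n]) ⊆ [dℓ]`. Then `F ∘ S_{[n]} = S_A ∘ F`, where `S_{[n]}` and `S_A` are the
cyclic successor functions on `[n]` and on `A`. -/
theorem stmt16 (n ℓ : ℕ) (hn : 1 ≤ n) (hl : 1 ≤ ℓ)
    (g : ℕ) (hg : g = Nat.gcd n ℓ) (hg1 : 1 < g) (hg2 : g < ℓ)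
    (d : ℕ) (hd : d = n / g)
    (A : Finset ℕ) (hA : A = (Finset.Icc 1 n).image (Fmap g ℓ)) :
    ∀ y ∈ Finset.Icc 1 n,
      Fmap g ℓ (cyclicSucc (Finset.Icc 1 n) y) = cyclicSucc A (Fmap g ℓ y) := by
  subst hA
  intro y hy
  refine StrictMonoOn.map_cyclicSucc ?_ hy
  exact (strictMonoOn_Fmap (by omega) hg2.le).mono fun x hx => (Finset.mem_Icc.1 hx).1
end
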